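/- Let φ : ℝ → ℝ be a continuous mapping, let S ⊂ ℝ be a finite set, and let N ≥ 4 be an integer. Suppose that for every x, y ∈ ℝ there exist a vector v = (v1,v2,v3,v4) ∈ V and a vector k = (k1,k2,k3,k4) ∈ [1,N]⁴ ∩ ℤ₀⁴ such that v1·φ(x+k1·y) + v2·φ(x+k2·y) + v3·φ(x+k3·y) + v4·φ(x+k4·y) ∈ S. Then the set of nonlinearity E(φ) has Lebesgue measure zero. -/

import Mathlib

open MeasureTheory Set

/-- The set of nonlinearity of `φ`: points having no open neighborhood
on which `φ` coincides with an affine function. -/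
def NonlinSet (φ : ℝ → ℝ) : Set ℝ :=
  {t | ¬ ∃ ε > (0 : ℝ), ∃ p q : ℝ, ∀ u : ℝ, |u - t| < ε → φ u = p * u + q}

/-- The family `V` of seven vectors in `ℝ⁴`. -/
def Vfam : Set (Fin 4 → ℝ) :=
  { ![1, 1, -1, -1], ![1, 1, -2, 0], ![1, -1, 0, 0], ![1, 1, 0, 0],
    ![2, 0, 0, 0], ![1, 1, -1, 0], ![1, 0, 0, 0] }

def Most (R e : ℝ) (P : ℝ → Prop) : Prop :=
  volume {u : ℝ | |u| ≤ R ∧ ¬ P u} ≤ ENNReal.ofReal e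

lemma Most.mono {R R' e e' : ℝ} {P P' : ℝ → Prop} (h : Most R e P) (hR : R' ≤ R) (he : e ≤ e')
    (hP : ∀ u, |u| ≤ R' → P u → P' u) : Most R' e' P' := by
  refine le_trans (measure_mono ?_) (h.trans (ENNReal.ofReal_le_ofReal he))
  rintro u ⟨h1, h2⟩
  exact ⟨h1.trans hR, fun h => h2 (hP u h1 h)⟩

lemma Most.and {R e e' : ℝ} {P P' : ℝ → Prop} (he : 0 ≤ e) (he' : 0 ≤ e')
    (h : Most R e P) (h' : Most R e' P') :
    Most R (e + e') (fun u => P u ∧ P' u) := by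
  unfold Most
  rw [ENNReal.ofReal_add he he']
  refine le_trans (le_trans (measure_mono ?_) (measure_union_le _ _)) (add_le_add h h')
  rintro u ⟨h1, h2⟩
  by_cases h3 : P u
  · right; exact ⟨h1, fun h => h2 ⟨h3, h⟩⟩
  · left; exact ⟨h1, h3⟩

lemma Most.shift {R R' e b : ℝ} {P : ℝ → Prop} (h : Most R e P) (hb : R' + |b| ≤ R) :
    Most R' e (fun u => P (u + b)) := by
  refine le_trans ?_ h
  rw [← measure_preimage_add_right volume b {u : ℝ | |u| ≤ R ∧ ¬ P u}]
  refine measure_mono ?_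
  rintro u ⟨h1, h2⟩
  exact ⟨(abs_add_le u b).trans (by linarith), h2⟩

lemma volume_abs_le (R : ℝ) : volume {u : ℝ | |u| ≤ R} = ENNReal.ofReal (2 * R) := by
  have : {u : ℝ | |u| ≤ R} = Icc (-R) R := by ext u; simp [abs_le]
  rw [this, Real.volume_Icc]; congr 1; ring

lemma Most.pos {R e : ℝ} {P : ℝ → Prop} (h : Most R e P) (he : e < 2 * R) (hR : 0 < R) :
    0 < volume {u : ℝ | |u| ≤ R ∧ P u} := by
  by_contra h0
  have h0 : volume {u : ℝ | |u| ≤ R ∧ P u} = 0 := by simpa using h0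
  have h1 : volume {u : ℝ | |u| ≤ R} ≤ volume {u : ℝ | |u| ≤ R ∧ P u} +
      volume {u : ℝ | |u| ≤ R ∧ ¬ P u} := by
    refine le_trans (measure_mono ?_) (measure_union_le _ _)
    intro u hu
    by_cases h3 : P u
    · left; exact ⟨hu, h3⟩
    · right; exact ⟨hu, h3⟩
  rw [h0, zero_add, volume_abs_le] at h1
  have h2 := h1.trans h
  rw [ENNReal.ofReal_le_ofReal_iff'] at h2
  rcases h2 with h2 | h2 <;> linarith

lemma Most.exists {R e : ℝ} {P : ℝ → Prop} (h : Most R e P) (he : e < 2 * R) (hR : 0 < R) :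
    ∃ u, |u| ≤ R ∧ P u :=
  nonempty_of_measure_ne_zero (h.pos he hR).ne'

lemma most_const {g : ℝ → ℝ} (hg : Continuous g) {R e : ℝ} (hR : 0 < R) (he : 0 < e)
    (h : ∀ a, |a| ≤ 2 * R → Most R e (fun u => g (u + a) = g u)) :
    ∃ m, Most R (3 * e) (fun u => g u = m) := by
  by_contra hcon
  push Not at hcon
  set B : Set (ℝ × ℝ) := {z | |z.1| ≤ R ∧ |z.2| ≤ R ∧ ¬ g z.2 = g z.1} with hB
  have hBm : MeasurableSet B := by
    refine MeasurableSet.inter ?_ (MeasurableSet.inter ?_ ?_)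
    · exact (isClosed_le (f := fun z : ℝ × ℝ => |z.1|) (g := fun _ => R)
        (by fun_prop) (by fun_prop)).measurableSet
    · exact (isClosed_le (f := fun z : ℝ × ℝ => |z.2|) (g := fun _ => R)
        (by fun_prop) (by fun_prop)).measurableSet
    · exact (isClosed_eq (by fun_prop) (by fun_prop)).measurableSet.compl
  have h1 : ENNReal.ofReal (3 * e) * ENNReal.ofReal (2 * R) ≤ volume B := by
    rw [Measure.volume_eq_prod, Measure.prod_apply hBm, ← volume_abs_le R, ← setLIntegral_const,
      ← lintegral_indicator (isClosed_le (by fun_prop) (by fun_prop)).measurableSet]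
    refine lintegral_mono fun u => ?_
    by_cases hu : |u| ≤ R
    · rw [indicator_of_mem (by exact hu)]
      have := hcon (g u)
      unfold Most at this
      push Not at this
      refine this.le.trans (measure_mono ?_)
      rintro w ⟨h1, h2⟩
      exact ⟨hu, h1, h2⟩
    · rw [indicator_of_notMem (by exact hu)]; exact zero_le
  have h2 : volume B ≤ ENNReal.ofReal e * ENNReal.ofReal (2 * (2 * R)) := by
    have hmp := measurePreserving_prod_add (volume : Measure ℝ) (volume : Measure ℝ)
    rw [Measure.volume_eq_prod, ← hmp.measure_preimage hBm.nullMeasurableSet,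
      Measure.prod_apply_symm (hmp.measurable hBm), ← volume_abs_le (2 * R), ← setLIntegral_const,
      ← lintegral_indicator (isClosed_le (by fun_prop) (by fun_prop)).measurableSet]
    refine lintegral_mono fun a => ?_
    by_cases ha : |a| ≤ 2 * R
    · rw [indicator_of_mem (by exact ha)]
      refine le_trans (measure_mono ?_) (h a ha)
      rintro u ⟨h1, h2, h3⟩
      exact ⟨h1, h3⟩
    · have : (fun x : ℝ => (x, a)) ⁻¹' ((fun z : ℝ × ℝ => (z.1, z.1 + z.2)) ⁻¹' B) = ∅ := by
        ext u
        simp only [mem_preimage, mem_empty_iff_false, iff_false]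
        rintro ⟨h1, h2, h3⟩
        apply ha
        simp only at h1 h2
        rw [abs_le] at *
        constructor <;> linarith
      rw [this]; simp
  have h3 := h1.trans h2
  rw [← ENNReal.ofReal_mul (by positivity), ← ENNReal.ofReal_mul (by positivity),
    ENNReal.ofReal_le_ofReal_iff (by positivity)] at h3
  nlinarith [mul_pos he hR]

lemma local_additive {m : ℝ → ℝ} {R K : ℝ} (hR : 0 < R)
    (hadd : ∀ a b, |a| ≤ R → |b| ≤ R → |a + b| ≤ R → m (a + b) = m a + m b)
    (hb : ∀ a, |a| ≤ R → |m a| ≤ K) : ∃ σ, ∀ a, |a| ≤ R → m a = σ * a := by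
  refine ⟨m R / R, ?_⟩
  set σ := m R / R with hσ
  set d : ℝ → ℝ := fun a => m a - σ * a with hd
  have dadd : ∀ a b, |a| ≤ R → |b| ≤ R → |a + b| ≤ R → d (a + b) = d a + d b := by
    intro a b h1 h2 h3
    simp only [hd, hadd a b h1 h2 h3]; ring
  have dR : d R = 0 := by simp only [hd, hσ]; field_simp; ring
  have d0 : d 0 = 0 := by
    have := dadd 0 0 (by simp [hR.le]) (by simp [hR.le]) (by simp [hR.le])
    simp at this; exact this
  have dneg : ∀ a, |a| ≤ R → d (-a) = - d a := by
    intro a ha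
    have := dadd a (-a) ha (by simpa using ha) (by simp [hR.le])
    rw [add_neg_cancel, d0] at this; linarith
  obtain ⟨C, hC⟩ : ∃ C, ∀ a, |a| ≤ R → |d a| ≤ C := by
    refine ⟨K + |σ| * R, fun a ha => ?_⟩
    calc |d a| ≤ |m a| + |σ * a| := abs_sub _ _
      _ ≤ K + |σ| * R := by
        rw [abs_mul]; exact add_le_add (hb a ha) (mul_le_mul_of_nonneg_left ha (abs_nonneg _))
  have key : ∀ n : ℕ, ∀ a, 0 ≤ a → a ≤ R → |d a| ≤ C * (1 / 2) ^ n := by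
    intro n
    induction n with
    | zero => intro a h1 h2; simpa using hC a (by rwa [abs_of_nonneg h1])
    | succ n ih =>
      intro a h1 h2
      have : ∃ a', 0 ≤ a' ∧ a' ≤ R ∧ d a' = 2 * d a := by
        by_cases h : 2 * a ≤ R
        · refine ⟨2 * a, by linarith, h, ?_⟩
          have ha : |a| ≤ R := by rw [abs_of_nonneg h1]; exact h2
          have := dadd a a ha ha (by rw [abs_of_nonneg (by linarith)]; linarith)
          rw [two_mul, this]; ring
        · push Not at h
          have ha : |a| ≤ R := by rw [abs_of_nonneg h1]; exact h2
          have hR' : |(-R)| ≤ R := by rw [abs_neg, abs_of_pos hR]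
          have haR : |a + -R| ≤ R := by rw [abs_le]; constructor <;> linarith
          have e1 := dadd a (-R) ha hR' haR
          have e2 := dadd a (a + -R) ha haR (by rw [abs_le]; constructor <;> linarith)
          have e3 := dneg R (by rw [abs_of_pos hR])
          refine ⟨a + (a + -R), by linarith, by linarith, ?_⟩
          rw [e2, e1, e3, dR]; ring
      obtain ⟨a', h3, h4, h5⟩ := this
      have := ih a' h3 h4
      rw [h5, abs_mul, abs_two] at this
      rw [pow_succ]; linarith
  have hpos : ∀ a, 0 ≤ a → a ≤ R → d a = 0 := by
    intro a h1 h2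
    have ht : Filter.Tendsto (fun n : ℕ => C * (1 / 2 : ℝ) ^ n) Filter.atTop (nhds (C * 0)) :=
      (tendsto_pow_atTop_nhds_zero_of_lt_one (by norm_num) (by norm_num)).const_mul C
    have := ge_of_tendsto' ht (fun n => key n a h1 h2)
    rw [mul_zero] at this
    exact abs_eq_zero.mp (le_antisymm this (abs_nonneg _))
  intro a ha
  have : d a = 0 := by
    rcases le_total 0 a with h | h
    · exact hpos a h (abs_le.mp ha).2
    · have h1 := hpos (-a) (by linarith) (by linarith [(abs_le.mp ha).1])
      rw [dneg a ha] at h1; linarith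
  simp only [hd] at this; linarith

lemma most_lin {h : ℝ → ℝ} (hc : Continuous h) {R e : ℝ} (hR : 0 < R) (he : 0 < e)
    (heR : 3 * e < R)
    (H : ∀ b, |b| ≤ R → ∃ m, Most R e (fun u => h (u + b) - h u = m)) :
    ∃ σ τ, Most (R / 2) (3 * e) (fun u => h u = σ * u + τ) := by
  choose! m hm using H
  obtain ⟨K, hK⟩ := (isCompact_Icc (a := -(2 * R)) (b := 2 * R)).exists_bound_of_continuousOn
    hc.continuousOn
  have hlin : ∃ σ, ∀ a, |a| ≤ R / 2 → m a = σ * a := by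
    refine local_additive (K := 2 * K) (by linarith) ?_ ?_
    · intro a b ha hb hab
      have h1 := (hm a (by linarith)).shift (R' := R / 2) (b := b) (by linarith)
      have h2 := (hm b (by linarith)).mono (R' := R / 2) (by linarith) le_rfl (fun _ _ h => h)
      have h3 := (hm (a + b) (by linarith)).mono (R' := R / 2) (by linarith) le_rfl
        (fun _ _ h => h)
      obtain ⟨u, -, ⟨e1, e2⟩, e3⟩ := ((h1.and he.le he.le h2).and (by linarith) he.le h3).exists
        (by linarith) (by linarith)
      rw [← e1, ← e2, ← e3, show u + b + a = u + (a + b) by ring]; ring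
    · intro a ha
      obtain ⟨u, hu, e1⟩ := (hm a (by linarith)).exists (by linarith) (by linarith)
      rw [← e1]
      rw [abs_le] at ha hu
      have k1 := hK (u + a) ⟨by linarith, by linarith⟩
      have k2 := hK u ⟨by linarith, by linarith⟩
      rw [Real.norm_eq_abs] at k1 k2
      exact (abs_sub _ _).trans (by linarith)
  obtain ⟨σ, hσ⟩ := hlin
  have hzero : ∀ b, |b| ≤ R → m b = σ * b := by
    intro b hb
    have hb2 : |b / 2| ≤ R / 2 := by rw [abs_div, abs_two]; linarith
    have h1 := (hm (b / 2) (by linarith)).shift (R' := R / 2) (b := b / 2) (by linarith)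
    have h2 := (hm (b / 2) (by linarith)).mono (R' := R / 2) (by linarith) le_rfl
      (fun _ _ h => h)
    have h3 := (hm b hb).mono (R' := R / 2) (by linarith) le_rfl (fun _ _ h => h)
    obtain ⟨u, -, ⟨e1, e2⟩, e3⟩ := ((h1.and he.le he.le h2).and (by linarith) he.le h3).exists
      (by linarith) (by linarith)
    rw [hσ _ hb2] at e1 e2
    rw [show u + b / 2 + b / 2 = u + b by ring] at e1
    linarith
  obtain ⟨τ, hτ⟩ := most_const (g := fun u => h u - σ * u) (R := R / 2) (e := e) (by fun_prop)
    (by linarith) he (by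
      intro a ha
      refine (hm a (by linarith)).mono (by linarith) le_rfl ?_
      intro u _ hu
      rw [hzero a (by linarith)] at hu
      linarith)
  refine ⟨σ, τ, hτ.mono le_rfl le_rfl ?_⟩
  intro u _ hu
  linarith

lemma most_quad {f : ℝ → ℝ} (hc : Continuous f) {R e : ℝ} (hR : 0 < R) (he : 0 < e)
    (heR : 200 * e < R)
    (H : ∀ a b c, |a| ≤ 2 * R → |b| ≤ 2 * R → |c| ≤ 2 * R → Most R e (fun u =>
      (f (u + a + b + c) - f (u + a + b)) - (f (u + a + c) - f (u + a)) =
      (f (u + b + c) - f (u + b)) - (f (u + c) - f u))) :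
    ∃ κ σ τ, Most (R / 8) (27 * e) (fun u => f u = κ * u ^ 2 + σ * u + τ) := by
  have H1 : ∀ c, |c| ≤ R → ∃ σ τ, Most (R / 2) (9 * e)
      (fun u => f (u + c) - f u = σ * u + τ) := by
    intro c hcR
    obtain ⟨σ, τ, h⟩ := most_lin (h := fun u => f (u + c) - f u) (R := R) (e := 3 * e)
      (by fun_prop) hR (by linarith) (by linarith) (by
        intro b hb
        refine most_const (g := fun u => (f (u + b + c) - f (u + b)) - (f (u + c) - f u))
          (by fun_prop) hR he ?_
        intro a ha
        exact H a b c ha (by linarith) (by linarith))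
    exact ⟨σ, τ, h.mono le_rfl (by linarith) (fun _ _ h => h)⟩
  choose! σ τ hστ using H1
  have hsym : ∀ b c, |b| ≤ R / 4 → |c| ≤ R / 4 → σ c * b = σ b * c := by
    intro b c hb hc
    have b1 := (hστ b (by linarith)).mono (R' := R / 4) (by linarith) le_rfl (fun _ _ h => h)
    have b2 := (hστ b (by linarith)).shift (R' := R / 4) (b := c) (by linarith)
    have c1 := (hστ c (by linarith)).mono (R' := R / 4) (by linarith) le_rfl (fun _ _ h => h)
    have c2 := (hστ c (by linarith)).shift (R' := R / 4) (b := b) (by linarith)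
    obtain ⟨u, -, ⟨e1, e2⟩, e3, e4⟩ := ((b1.and (by linarith) (by linarith) b2).and
      (by linarith) (by linarith) (c1.and (by linarith) (by linarith) c2)).exists
      (by linarith) (by linarith)
    rw [show u + c + b = u + b + c by ring] at e2
    linarith
  set κ := σ (R / 4) / (R / 4) with hκ
  have hσ : ∀ c, |c| ≤ R / 4 → σ c = κ * c := by
    intro c hc
    have := hsym (R / 4) c (by rw [abs_of_pos (by linarith)]) hc
    rw [hκ]; field_simp at this ⊢; linarith
  obtain ⟨α, β, h⟩ := most_lin (h := fun u => f u - κ / 2 * u ^ 2) (R := R / 4) (e := 9 * e)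
    (by fun_prop) (by linarith) (by linarith) (by linarith) (by
      intro c hc
      refine ⟨τ c - κ / 2 * c ^ 2, (hστ c (by linarith)).mono (by linarith) le_rfl ?_⟩
      intro u _ hu
      rw [hσ c hc] at hu
      linear_combination hu)
  refine ⟨κ / 2, α, β, h.mono (by linarith) (by linarith) ?_⟩
  intro u _ hu
  linarith
lemma density_pt {β : Type*} [NormedAddCommGroup β] [NormedSpace ℝ β] [FiniteDimensional ℝ β]
    [MeasureSpace β] [BorelSpace β] [(volume : Measure β).IsAddHaarMeasure]
    {s : Set β} (hs : MeasurableSet s) :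
    ∀ᵐ x : β, x ∈ s → ∀ η : ℝ, 0 < η → ∃ r0 > 0, ∀ r, 0 < r → r < r0 →
      volume (sᶜ ∩ Metric.closedBall x r) ≤ ENNReal.ofReal η * volume (Metric.closedBall x r) := by
  filter_upwards [Besicovitch.ae_tendsto_measure_inter_div_of_measurableSet volume hs.compl]
    with x hx hxs η hη
  rw [indicator_of_notMem (by simpa using hxs)] at hx
  have h1 := hx.eventually (gt_mem_nhds (ENNReal.ofReal_pos.mpr hη))
  rw [eventually_nhdsWithin_iff, Metric.eventually_nhds_iff] at h1
  obtain ⟨r0, hr0, h⟩ := h1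
  refine ⟨r0, hr0, fun r hr hrr => ?_⟩
  have h2 := h (y := r) (by rwa [Real.dist_eq, sub_zero, abs_of_pos hr]) hr
  have hpos : volume (Metric.closedBall x r) ≠ 0 :=
    (Metric.measure_closedBall_pos volume x hr).ne'
  have hfin : volume (Metric.closedBall x r) ≠ ⊤ := measure_closedBall_lt_top.ne
  exact (ENNReal.div_le_iff hpos hfin).mp h2.le


lemma volume_closedBall_prod (z : ℝ × ℝ) (r : ℝ) (hr : 0 < r) :
    volume (Metric.closedBall z r) = ENNReal.ofReal (4 * r ^ 2) := by
  obtain ⟨x, y⟩ := z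
  rw [← closedBall_prod_same, Measure.volume_eq_prod, Measure.prod_prod, Real.volume_closedBall,
    Real.volume_closedBall, ← ENNReal.ofReal_mul (by positivity)]
  congr 1; ring

lemma most_proj {ι : Type*} [Fintype ι] (w : ι → ℝ × ℝ) {Γ : Set (ℝ × ℝ)} {R ε : ℝ} (hR : 0 < R)
    (hε : 0 ≤ ε)
    (hΓ : volume (Γᶜ ∩ Metric.closedBall 0 (7 * R)) ≤ ENNReal.ofReal ε)
    (hw : ∀ i, ‖w i‖ ≤ 6 * R) :
    Most R (Fintype.card ι * ε / (2 * R)) (fun u => ∃ y, ∀ i, (u, y) + w i ∈ Γ) := by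
  unfold Most
  set B := {u : ℝ | |u| ≤ R ∧ ¬ ∃ y, ∀ i, (u, y) + w i ∈ Γ} with hB
  have h1 : B ×ˢ {y : ℝ | |y| ≤ R} ⊆
      ⋃ i, (fun z => z + w i) ⁻¹' (Γᶜ ∩ Metric.closedBall 0 (7 * R)) := by
    rintro ⟨u, y⟩ ⟨⟨hu, hu2⟩, hy⟩
    push Not at hu2
    obtain ⟨i, hi⟩ := hu2 y
    refine mem_iUnion.mpr ⟨i, hi, ?_⟩
    rw [mem_closedBall_zero_iff]
    refine (norm_add_le _ _).trans ?_
    have : ‖(u, y)‖ ≤ R := by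
      rw [Prod.norm_mk]; exact max_le hu hy
    linarith [hw i]
  have h2 : volume B * ENNReal.ofReal (2 * R) ≤ Fintype.card ι * ENNReal.ofReal ε := by
    rw [← volume_abs_le, ← Measure.prod_prod, ← Measure.volume_eq_prod]
    refine (measure_mono h1).trans ((measure_iUnion_fintype_le _ _).trans ?_)
    calc _ ≤ ∑ i : ι, ENNReal.ofReal ε := by
          refine Finset.sum_le_sum fun i _ => ?_
          rw [measure_preimage_add_right]; exact hΓ
      _ = _ := by simp
  rw [ENNReal.ofReal_div_of_pos (by positivity), ENNReal.ofReal_mul (by positivity),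
    ENNReal.ofReal_natCast]
  rw [ENNReal.le_div_iff_mul_le (by left; simpa using hR) (by left; exact ENNReal.ofReal_ne_top)]
  exact h2

lemma stage_one_aux {f g2 g3 g4 : ℝ → ℝ} (hf : Continuous f) {n2 n3 n4 s : ℝ}
    (h2 : 1 ≤ |n2|) (h3 : 1 ≤ |n3|) (h4 : 1 ≤ |n4|) {Γ : Set (ℝ × ℝ)} {R : ℝ} (hR : 0 < R)
    (hΓ : volume (Γᶜ ∩ Metric.closedBall 0 (7 * R)) ≤ ENNReal.ofReal (R ^ 2 / 2000))
    (heq : ∀ u y, (u, y) ∈ Γ → f u + g2 (u + n2 * y) + g3 (u + n3 * y) + g4 (u + n4 * y) = s) :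
    ∃ κ σ τ : ℝ, 0 < volume {u : ℝ | f u = κ * u ^ 2 + σ * u + τ ∧ ∃ y, (u, y) ∈ Γ} := by
  have hdiv : ∀ a n : ℝ, 1 ≤ |n| → |a| ≤ 2 * R → |a / n| ≤ 2 * R := by
    intro a n hn ha
    rw [abs_div]
    exact (div_le_self (abs_nonneg _) hn).trans ha
  have hne : ∀ n : ℝ, 1 ≤ |n| → n ≠ 0 := by
    rintro n hn rfl; norm_num at hn
  have hn2 := hne n2 h2
  have hn3 := hne n3 h3
  have hn4 := hne n4 h4
  obtain ⟨κ, σ, τ, hm⟩ := most_quad (f := f) (R := R) (e := R / 500) hf hR (by linarith)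
    (by linarith) (by
      intro a b c ha hb hc
      obtain ⟨A, rfl⟩ : ∃ A, a = n2 * A := ⟨a / n2, by field_simp⟩
      obtain ⟨B, rfl⟩ : ∃ B, b = n3 * B := ⟨b / n3, by field_simp⟩
      obtain ⟨C, rfl⟩ : ∃ C, c = n4 * C := ⟨c / n4, by field_simp⟩
      let w : Bool × Bool × Bool → ℝ × ℝ := fun i =>
        (bif i.1 then (n2 * A, -(n2 * A / n2)) else 0) + (bif i.2.1 then (n3 * B, -(n3 * B / n3)) else 0) +
        (bif i.2.2 then (n4 * C, -(n4 * C / n4)) else 0)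
      have hw : ∀ i, ‖w i‖ ≤ 6 * R := by
        intro i
        have key : ∀ (t : Bool) (a n : ℝ), 1 ≤ |n| → |a| ≤ 2 * R →
            ‖(bif t then ((a, -(a / n)) : ℝ × ℝ) else 0)‖ ≤ 2 * R := by
          intro t a n hn ha
          cases t
          · simp; linarith
          · simp only [cond_true, Prod.norm_mk, Real.norm_eq_abs, abs_neg]
            exact max_le ha (hdiv a n hn ha)
        refine (norm_add₃_le).trans ?_
        linarith [key i.1 (n2 * A) n2 h2 ha, key i.2.1 (n3 * B) n3 h3 hb,
          key i.2.2 (n4 * C) n4 h4 hc]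
      refine (most_proj w hR (by positivity) hΓ hw).mono le_rfl ?_ ?_
      · simp only [Fintype.card_prod, Fintype.card_bool]
        push_cast
        rw [div_le_iff₀ (by positivity)]
        nlinarith
      · rintro u - ⟨y, hy⟩
        have e000 := heq _ _ (hy (false, false, false))
        have e001 := heq _ _ (hy (false, false, true))
        have e010 := heq _ _ (hy (false, true, false))
        have e011 := heq _ _ (hy (false, true, true))
        have e100 := heq _ _ (hy (true, false, false))
        have e101 := heq _ _ (hy (true, false, true))
        have e110 := heq _ _ (hy (true, true, false))
        have e111 := heq _ _ (hy (true, true, true))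
        simp only [cond_true, cond_false, Prod.fst_add, Prod.snd_add, Prod.fst_zero,
          Prod.snd_zero, add_zero, zero_add, w,
          mul_div_cancel_left₀ _ hn2, mul_div_cancel_left₀ _ hn3, mul_div_cancel_left₀ _ hn4] at e000 e001 e010 e011 e100 e101 e110 e111
        clear hΓ hdiv heq hy ha hb hc hw
        ring_nf at e000 e001 e010 e011 e100 e101 e110 e111 ⊢
        linarith)
  have hm2 : Most (R / 8) (R / 500) (fun u => ∃ y, (u, y) ∈ Γ) := by
    refine (most_proj (fun _ : Unit => 0) hR (by positivity) hΓ
      (by intro i; simp; linarith)).mono (by linarith) ?_ ?_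
    · simp
      rw [div_le_iff₀ (by positivity)]
      nlinarith
    · rintro u - ⟨y, hy⟩
      exact ⟨y, by simpa using hy ()⟩
  refine ⟨κ, σ, τ, ((hm.and (by positivity) (by positivity) hm2).pos (by linarith)
    (by linarith)).trans_le (measure_mono ?_)⟩
  rintro u ⟨-, h⟩
  exact h

lemma stage_one {f g2 g3 g4 : ℝ → ℝ} (hf : Continuous f) {n2 n3 n4 s : ℝ}
    (h2 : 1 ≤ |n2|) (h3 : 1 ≤ |n3|) (h4 : 1 ≤ |n4|) {Γ : Set (ℝ × ℝ)} (hΓm : MeasurableSet Γ)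
    (hΓ : 0 < volume Γ)
    (heq : ∀ u y, (u, y) ∈ Γ → f u + g2 (u + n2 * y) + g3 (u + n3 * y) + g4 (u + n4 * y) = s) :
    ∃ κ σ τ : ℝ, 0 < volume {u : ℝ | f u = κ * u ^ 2 + σ * u + τ ∧ ∃ y, (u, y) ∈ Γ} := by
  obtain ⟨z0, hz0, hd⟩ : ∃ z0 ∈ Γ, ∀ η : ℝ, 0 < η → ∃ r0 > 0, ∀ r, 0 < r → r < r0 →
      volume (Γᶜ ∩ Metric.closedBall z0 r) ≤
        ENNReal.ofReal η * volume (Metric.closedBall z0 r) := by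
    by_contra hcon
    push Not at hcon
    refine hΓ.ne' (measure_mono_null ?_ (density_pt hΓm))
    intro z hz h
    obtain ⟨η, h1, h2⟩ := hcon z hz
    obtain ⟨r0, h3, h4⟩ := h hz η h1
    obtain ⟨r, h5, h6, h7⟩ := h2 r0 h3
    exact absurd (h4 r h5 h6) (not_le.mpr h7)
  obtain ⟨r0, hr0, h⟩ := hd (1 / 400000) (by norm_num)
  set R := r0 / 14 with hRdef
  have hR : 0 < R := by positivity
  have hb := h (7 * R) (by positivity) (by rw [hRdef]; linarith)
  rw [volume_closedBall_prod _ _ (by positivity), ← ENNReal.ofReal_mul (by norm_num)] at hb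
  obtain ⟨u0, y0⟩ := z0
  obtain ⟨κ, σ, τ, hpos⟩ := stage_one_aux (f := fun u => f (u + u0))
    (g2 := fun t => g2 (t + (u0 + n2 * y0))) (g3 := fun t => g3 (t + (u0 + n3 * y0)))
    (g4 := fun t => g4 (t + (u0 + n4 * y0))) (s := s)
    (Γ := (fun z => z + (u0, y0)) ⁻¹' Γ) (by fun_prop) h2 h3 h4 hR (by
      refine le_trans ?_ (hb.trans (ENNReal.ofReal_le_ofReal (by nlinarith [sq_nonneg R])))
      rw [← measure_preimage_add_right volume (u0, y0)
        (Γᶜ ∩ Metric.closedBall (u0, y0) (7 * R))]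
      refine measure_mono ?_
      rintro z ⟨h1, h2⟩
      refine ⟨h1, ?_⟩
      rw [mem_closedBall_zero_iff] at h2
      rw [mem_closedBall_iff_norm, add_sub_cancel_right]
      exact h2) (by
      intro u y hu
      have := heq (u + u0) (y + y0) hu
      rw [← this]
      ring_nf)
  refine ⟨κ, σ - 2 * κ * u0, κ * u0 ^ 2 - σ * u0 + τ, ?_⟩
  rw [← measure_preimage_add_right volume u0]
  refine hpos.trans_le (measure_mono ?_)
  rintro u ⟨h1, y, hy⟩
  refine ⟨?_, y + y0, hy⟩
  simp only at h1 ⊢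
  rw [h1]; ring

def IsDens (G : Set ℝ) (p : ℝ) : Prop :=
  ∀ η : ℝ, 0 < η → ∃ r0 > 0, ∀ r, 0 < r → r < r0 →
    volume (Gᶜ ∩ Metric.closedBall p r) ≤ ENNReal.ofReal (η * r)

lemma ae_isDens {G : Set ℝ} (hG : MeasurableSet G) : ∀ᵐ x : ℝ, x ∈ G → IsDens G x := by
  filter_upwards [density_pt hG] with x hx hxG η hη
  obtain ⟨r0, hr0, h⟩ := hx hxG (η / 2) (by positivity)
  refine ⟨r0, hr0, fun r hr hrr => (h r hr hrr).trans ?_⟩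
  rw [Real.volume_closedBall, ← ENNReal.ofReal_mul (by positivity)]
  apply ENNReal.ofReal_le_ofReal
  linarith

lemma IsDens.of_null {G D : Set ℝ} {p : ℝ} (h : IsDens G p) (hn : volume (G \ D) = 0) :
    IsDens D p := by
  intro η hη
  obtain ⟨r0, hr0, h⟩ := h η hη
  refine ⟨r0, hr0, fun r hr hrr => le_trans ?_ (h r hr hrr)⟩
  calc volume (Dᶜ ∩ Metric.closedBall p r)
      ≤ volume ((Gᶜ ∩ Metric.closedBall p r) ∪ (G \ D)) := by
        refine measure_mono ?_
        rintro u ⟨h1, h2⟩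
        by_cases hu : u ∈ G
        · right; exact ⟨hu, h1⟩
        · left; exact ⟨hu, h2⟩
    _ ≤ _ := (measure_union_le _ _).trans (by rw [hn, add_zero])

lemma dens_line {D : Set ℝ} {p : ℝ} (h : IsDens D p) {M η : ℝ} (hM : 1 ≤ M) (hη : 0 < η) (m : ℤ)
    (hm : m ≠ 0) (hmM : |(m : ℝ)| ≤ M) :
    ∀ᶠ r in nhdsWithin (0 : ℝ) (Ioi 0), ∀ a, |a| ≤ r →
      Most r (η * r) (fun τ => p + a + m * τ ∈ D) := by
  obtain ⟨r0, hr0, h⟩ := h (η / (M + 1)) (by positivity)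
  have : Ioo 0 (r0 / (M + 1)) ∈ nhdsWithin (0 : ℝ) (Ioi 0) :=
    Ioo_mem_nhdsGT (by positivity)
  filter_upwards [this] with r hr a ha
  obtain ⟨hr1, hr2⟩ := hr
  rw [lt_div_iff₀ (by positivity)] at hr2
  have h1 := h (r * (M + 1)) (by positivity) hr2
  have h2 : η / (M + 1) * (r * (M + 1)) = η * r := by field_simp
  rw [h2] at h1
  refine le_trans ?_ h1
  have hm1 : (1 : ℝ) ≤ |(m : ℝ)| := by exact_mod_cast Int.one_le_abs hm
  have hm0 : (m : ℝ) ≠ 0 := by exact_mod_cast hm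
  set B := Dᶜ ∩ Metric.closedBall p (r * (M + 1))
  calc volume {τ : ℝ | |τ| ≤ r ∧ ¬ p + a + m * τ ∈ D}
      ≤ volume ((fun τ => (m : ℝ) * τ) ⁻¹' ((fun t => (p + a) + t) ⁻¹' B)) := by
        refine measure_mono ?_
        rintro τ ⟨h3, h4⟩
        refine ⟨h4, ?_⟩
        rw [mem_closedBall_iff_norm, Real.norm_eq_abs]
        have : |(m : ℝ) * τ| ≤ M * r := by
          rw [abs_mul]; exact mul_le_mul hmM h3 (abs_nonneg _) (by linarith)
        calc |p + a + m * τ - p| = |a + m * τ| := by congr 1; ring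
          _ ≤ |a| + |m * τ| := abs_add_le _ _
          _ ≤ r * (M + 1) := by linarith
    _ = ENNReal.ofReal |(m : ℝ)⁻¹| * volume B := by
        rw [Real.volume_preimage_mul_left hm0, measure_preimage_add]
    _ ≤ 1 * volume B := by
        gcongr
        rw [← ENNReal.ofReal_one]
        apply ENNReal.ofReal_le_ofReal
        rw [abs_inv]
        exact inv_le_one_of_one_le₀ hm1
    _ = volume B := one_mul _

lemma Most.finset {ι : Type*} (K : Finset ι) {R e : ℝ} (he : 0 ≤ e) {P : ι → ℝ → Prop}
    (h : ∀ k ∈ K, Most R e (P k)) : Most R (K.card * e) (fun u => ∀ k ∈ K, P k u) := by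
  classical
  induction K using Finset.induction_on with
  | empty => simp [Most]
  | insert a K ha ih =>
    have h1 := ih (fun k hk => h k (Finset.mem_insert_of_mem hk))
    have h2 := h a (Finset.mem_insert_self _ _)
    refine (h2.and he (by positivity) h1).mono le_rfl ?_ ?_
    · rw [Finset.card_insert_of_notMem ha]; push_cast; linarith
    · rintro u - ⟨h3, h4⟩ k hk
      rcases Finset.mem_insert.mp hk with rfl | hk
      · exact h3
      · exact h4 k hk

lemma dens_sel {D : Set ℝ} (K : Finset ℤ) (p : ℤ → ℝ) (m : ℤ → ℤ)
    (hp : ∀ k ∈ K, IsDens D (p k)) (hm : ∀ k ∈ K, m k ≠ 0) :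
    ∀ᶠ r in nhdsWithin (0 : ℝ) (Ioi 0), ∀ a, |a| ≤ r →
      Most r r (fun τ => ∀ k ∈ K, p k + a + m k * τ ∈ D) := by
  have h : ∀ᶠ r in nhdsWithin (0 : ℝ) (Ioi 0), ∀ k ∈ K, ∀ a, |a| ≤ r →
      Most r (1 / (K.card + 1) * r) (fun τ => p k + a + m k * τ ∈ D) := by
    rw [Filter.eventually_all_finset]
    intro k hk
    exact dens_line (hp k hk) (M := |(m k : ℝ)| + 1) (by linarith [abs_nonneg (m k : ℝ)])
      (by positivity) (m k) (hm k hk) (by linarith)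
  filter_upwards [h, self_mem_nhdsWithin] with r hr hr0 a ha
  have hr0 : 0 < r := hr0
  refine (Most.finset K (by positivity) (fun k hk => hr k hk a ha)).mono le_rfl ?_ (fun _ _ h => h)
  rw [← mul_assoc]
  have : (K.card : ℝ) * (1 / (K.card + 1)) ≤ 1 := by
    rw [mul_one_div, div_le_one (by positivity)]; linarith
  nlinarith

lemma ap_pos {D : Set ℝ} {p : ℝ} (hp : IsDens D p) (N : ℤ) :
    0 < volume {z : ℝ × ℝ | ∀ k : ℤ, 1 ≤ k → k ≤ N → z.1 + k * z.2 ∈ D} := by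
  by_contra h0
  have h0 : volume {z : ℝ × ℝ | ∀ k : ℤ, 1 ≤ k → k ≤ N → z.1 + k * z.2 ∈ D} = 0 := by
    simpa using h0
  rw [Measure.volume_eq_prod] at h0
  have h1 := Measure.measure_ae_null_of_prod_null h0
  obtain ⟨r, hr, hr0⟩ := ((dens_sel (D := D) (Finset.Icc 1 N) (fun _ => p) id (fun _ _ => hp)
    (by intro k hk; rw [Finset.mem_Icc] at hk; simp only [id]; omega)).and
    self_mem_nhdsWithin).exists
  have hr0 : 0 < r := hr0
  have h2 : volume {x : ℝ | |x| ≤ r} = 0 := by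
    rw [← measure_preimage_add_right volume (-p)]
    refine measure_mono_null ?_ h1
    intro x hx hx2
    have h3 := (hr (x - p) (by simpa [sub_eq_add_neg] using hx)).pos (by linarith) hr0
    refine h3.ne' (measure_mono_null ?_ hx2)
    rintro y ⟨-, hy⟩ k hk1 hk2
    have := hy k (Finset.mem_Icc.mpr ⟨hk1, hk2⟩)
    simpa using this
  rw [volume_abs_le] at h2
  simp at h2
  linarith

lemma ap_step {D : Set ℝ} (hD : ∀ p ∈ D, IsDens D p) {ψ : ℝ → ℝ} (h0 : ∀ p ∈ D, ψ p = 0)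
    (hcl : ∀ p ∈ D, ∀ ε > 0, ∃ u, |u - p| < ε ∧ ψ u ≠ 0) {N n : ℤ} (hn : n + 1 ≤ N)
    {x y : ℝ} (hxy : ∀ k : ℤ, n < k → k ≤ N → x + k * y ∈ D) {U : Set (ℝ × ℝ)}
    (hU : U ∈ nhds (x, y)) :
    ∃ x' y' : ℝ, (x', y') ∈ U ∧ ψ (x' + (n + 1 : ℤ) * y') ≠ 0 ∧
      ∀ k : ℤ, n + 1 < k → k ≤ N → x' + k * y' ∈ D := by
  obtain ⟨δ, hδ, hball⟩ := Metric.mem_nhds_iff.mp hU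
  set p := x + (n + 1 : ℤ) * y with hp
  have hpD : p ∈ D := hxy (n + 1) (by omega) hn
  have hsel := dens_sel (D := D) (Finset.Icc (n + 2) N) (fun k => x + k * y)
    (fun k => k - (n + 1))
    (by intro k hk; rw [Finset.mem_Icc] at hk; exact hD _ (hxy k (by omega) hk.2))
    (by intro k hk; rw [Finset.mem_Icc] at hk; omega)
  rw [eventually_nhdsWithin_iff, Metric.eventually_nhds_iff] at hsel
  obtain ⟨r0, hr0, hsel⟩ := hsel
  set M : ℝ := 2 + |((n + 1 : ℤ) : ℝ)| with hM
  have hM0 : 0 < M := by positivity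
  obtain ⟨u, hu, hψ⟩ := hcl p hpD (min r0 (δ / M)) (lt_min hr0 (by positivity))
  have hr : 0 < |u - p| := by
    rw [abs_pos, sub_ne_zero]
    rintro rfl
    exact hψ (h0 _ hpD)
  obtain ⟨τ, hτ, hgood⟩ := (hsel (y := |u - p|)
    (by rw [Real.dist_eq, sub_zero, abs_abs]; exact hu.trans_le (min_le_left _ _)) hr
    (u - p) le_rfl).exists (by linarith) hr
  have hu2 : |u - p| * M < δ := (lt_div_iff₀ hM0).mp (hu.trans_le (min_le_right _ _))
  refine ⟨u - (n + 1 : ℤ) * (y + τ), y + τ, hball ?_, ?_, ?_⟩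
  · rw [mem_ball_iff_norm, Prod.mk_sub_mk, Prod.norm_mk, Real.norm_eq_abs, Real.norm_eq_abs]
    apply max_lt
    · calc |u - (n + 1 : ℤ) * (y + τ) - x| = |(u - p) - (n + 1 : ℤ) * τ| := by
            rw [hp]; congr 1; ring
        _ ≤ |u - p| + |((n + 1 : ℤ) : ℝ)| * |τ| := by
            rw [← abs_mul]; exact abs_sub _ _
        _ ≤ |u - p| * M := by
            rw [hM]; nlinarith [abs_nonneg ((n + 1 : ℤ) : ℝ)]
        _ < δ := hu2
    · rw [add_sub_cancel_left]
      refine hτ.trans_lt (lt_of_le_of_lt ?_ hu2)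
      rw [hM]; nlinarith [abs_nonneg ((n + 1 : ℤ) : ℝ)]
  · rwa [sub_add_cancel]
  · intro k hk1 hk2
    have := hgood k (Finset.mem_Icc.mpr ⟨by omega, hk2⟩)
    convert this using 1
    rw [hp]; push_cast; ring

lemma quad1_finite {a b c : ℝ} (h : ¬ (a = 0 ∧ b = 0 ∧ c = 0)) :
    {y : ℝ | a * y ^ 2 + b * y + c = 0}.Finite := by
  set P : Polynomial ℝ := Polynomial.C a * Polynomial.X ^ 2 + Polynomial.C b * Polynomial.X +
    Polynomial.C c with hP
  have hP0 : P ≠ 0 := by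
    intro h0
    apply h
    have e0 := congrArg (fun q => Polynomial.coeff q 0) h0
    have e1 := congrArg (fun q => Polynomial.coeff q 1) h0
    have e2 := congrArg (fun q => Polynomial.coeff q 2) h0
    simp [hP, Polynomial.coeff_X, Polynomial.coeff_C, Polynomial.coeff_X_pow] at e0 e1 e2
    exact ⟨e2, e1, e0⟩
  refine (Polynomial.finite_setOf_isRoot hP0).subset ?_
  intro y hy
  simpa [hP, Polynomial.IsRoot] using hy

lemma quad2_null {A B C D E F : ℝ}
    (h : ¬ (A = 0 ∧ B = 0 ∧ C = 0 ∧ D = 0 ∧ E = 0 ∧ F = 0)) :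
    volume {z : ℝ × ℝ | A * z.1 ^ 2 + B * z.1 * z.2 + C * z.2 ^ 2 + D * z.1 + E * z.2 + F = 0}
      = 0 := by
  have hm : MeasurableSet {z : ℝ × ℝ |
      A * z.1 ^ 2 + B * z.1 * z.2 + C * z.2 ^ 2 + D * z.1 + E * z.2 + F = 0} :=
    (isClosed_eq (by fun_prop) (by fun_prop)).measurableSet
  rw [Measure.volume_eq_prod, Measure.measure_prod_null hm]
  have hfin : {x : ℝ | C = 0 ∧ B * x + E = 0 ∧ A * x ^ 2 + D * x + F = 0}.Finite := by
    by_cases h1 : A = 0 ∧ D = 0 ∧ F = 0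
    · by_cases h2 : B = 0 ∧ E = 0
      · have : C ≠ 0 := by tauto
        simp [this]
      · refine (quad1_finite (a := 0) (b := B) (c := E) (by tauto)).subset ?_
        rintro x ⟨-, h3, -⟩
        simpa using h3
    · exact (quad1_finite h1).subset fun x hx => hx.2.2
  refine measure_mono_null (t := {x : ℝ | C = 0 ∧ B * x + E = 0 ∧ A * x ^ 2 + D * x + F = 0}) ?_
    (hfin.measure_zero _)
  intro x hx
  by_contra hcon
  apply hx
  refine ((quad1_finite hcon).subset ?_).measure_zero _
  intro y hy
  simp only [mem_preimage, mem_setOf_eq] at hy ⊢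
  linarith

lemma nonlin_closed (φ : ℝ → ℝ) : IsClosed (NonlinSet φ) := by
  rw [← isOpen_compl_iff, Metric.isOpen_iff]
  intro t ht
  simp only [NonlinSet, mem_compl_iff, mem_setOf_eq, not_not] at ht
  obtain ⟨ε, hε, p, q, h⟩ := ht
  refine ⟨ε / 2, by positivity, ?_⟩
  intro t' ht'
  rw [Metric.mem_ball, Real.dist_eq] at ht'
  simp only [NonlinSet, mem_compl_iff, mem_setOf_eq, not_not]
  refine ⟨ε / 2, by positivity, p, q, fun u hu => h u ?_⟩
  have := abs_sub_le u t' t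
  linarith

def Trip (S : Set ℝ) (N : ℤ) : Set ((Fin 4 → ℝ) × (Fin 4 → ℤ) × ℝ) :=
  {t | t.1 ∈ Vfam ∧ Function.Injective t.2.1 ∧ (∀ j, 1 ≤ t.2.1 j ∧ t.2.1 j ≤ N) ∧ t.2.2 ∈ S}

lemma trip_finite {S : Set ℝ} (hS : S.Finite) (N : ℤ) : (Trip S N).Finite := by
  have hV : Vfam.Finite := by unfold Vfam; exact Set.toFinite _
  have hk : {k : Fin 4 → ℤ | ∀ j, k j ∈ Icc 1 N}.Finite := by
    have := Set.Finite.pi' (fun _ : Fin 4 => Set.finite_Icc (1 : ℤ) N)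
    exact this
  refine (hV.prod (hk.prod hS)).subset ?_
  rintro ⟨v, k, s⟩ ⟨h1, -, h2, h3⟩
  exact ⟨h1, h2, h3⟩

lemma v_zero {v : Fin 4 → ℝ} (hv : v ∈ Vfam) : 1 ≤ v 0 := by
  rcases hv with rfl | rfl | rfl | rfl | rfl | rfl | rfl <;> norm_num

lemma v_bound {v : Fin 4 → ℝ} (hv : v ∈ Vfam) (j : Fin 4) :
    v j = 0 ∨ (1 ≤ |v j| ∧ |v j| ≤ 2) := by
  rcases hv with rfl | rfl | rfl | rfl | rfl | rfl | rfl <;> fin_cases j <;> norm_num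

lemma v_moment {v : Fin 4 → ℝ} (hv : v ∈ Vfam) {k : Fin 4 → ℤ} (hk : Function.Injective k)
    (h0 : ∑ j, v j = 0) (h1 : ∑ j, v j * k j = 0) (h2 : ∑ j, v j * (k j : ℝ) ^ 2 = 0) : False := by
  have hne : ∀ i j, i ≠ j → (k i : ℝ) - k j ≠ 0 := by
    intro i j hij h
    apply hij
    apply hk
    exact_mod_cast sub_eq_zero.mp h
  have h01 := hne 0 1 (by decide)
  have h02 := hne 0 2 (by decide)
  have h03 := hne 0 3 (by decide)
  rcases hv with rfl | rfl | rfl | rfl | rfl | rfl | rfl <;>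
    simp [Fin.sum_univ_four] at h0 h1 h2 <;> norm_num at h0
  · apply mul_ne_zero h02 h03
    have e : (k 3 : ℝ) = k 0 + k 1 - k 2 := by linarith
    rw [e] at h2 ⊢
    nlinarith
  · apply mul_ne_zero h01 h01
    have e : (k 2 : ℝ) = (k 0 + k 1) / 2 := by linarith
    rw [e] at h2
    nlinarith
  · apply h01; linarith

lemma lacunary {v : Fin 4 → ℝ} (hv : v ∈ Vfam) {k : Fin 4 → ℤ} (hk : Function.Injective k)
    {w : ℤ → ℝ} (hw : ∀ j, w (k j) ≠ 0)
    (hl : ∀ i j, k i < k j → 10 * |w (k j)| < |w (k i)|) :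
    ∑ j, v j * w (k j) ≠ 0 := by
  classical
  intro hsum
  obtain ⟨i, hi, hmin⟩ := Finset.exists_min_image (Finset.univ.filter (fun j => v j ≠ 0)) k
    ⟨0, by simp; linarith [v_zero hv]⟩
  simp only [Finset.mem_filter, Finset.mem_univ, true_and] at hi hmin
  have hpos : 0 < |w (k i)| := abs_pos.mpr (hw i)
  have hother : ∀ j, j ≠ i → |v j * w (k j)| ≤ |w (k i)| / 5 := by
    intro j hj
    by_cases hvj : v j = 0
    · rw [hvj, zero_mul, abs_zero]; positivity
    · have hlt : k i < k j := lt_of_le_of_ne (hmin j hvj) (fun h => hj (hk h.symm))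
      have h2 : |v j| ≤ 2 := by
        rcases v_bound hv j with h | h
        · exact absurd h hvj
        · exact h.2
      rw [abs_mul]
      have := hl i j hlt
      nlinarith [abs_nonneg (w (k j))]
  have h1 : |w (k i)| ≤ |v i * w (k i)| := by
    rcases v_bound hv i with h | h
    · exact absurd h hi
    · rw [abs_mul]; nlinarith
  rw [← Finset.add_sum_erase _ _ (Finset.mem_univ i)] at hsum
  have h2 : |∑ j ∈ Finset.univ.erase i, v j * w (k j)| ≤ 3 * (|w (k i)| / 5) := by
    refine (Finset.abs_sum_le_sum_abs _ _).trans ?_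
    refine (Finset.sum_le_card_nsmul _ _ _ (fun j hj => hother j (Finset.ne_of_mem_erase hj))).trans
      ?_
    rw [Finset.card_erase_of_mem (Finset.mem_univ i)]
    simp
  have h3 : v i * w (k i) = -∑ j ∈ Finset.univ.erase i, v j * w (k j) := by linarith
  rw [h3, abs_neg] at h1
  linarith

lemma quad_rel (κ σ τ : ℝ) (v : Fin 4 → ℝ) (k : Fin 4 → ℤ) (s : ℝ) :
    ((κ * ∑ j, v j = 0 ∧ κ * ∑ j, v j * k j = 0 ∧ κ * ∑ j, v j * (k j : ℝ) ^ 2 = 0) ∧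
      ∀ x y : ℝ, ∑ j, v j * (κ * (x + k j * y) ^ 2 + σ * (x + k j * y) + τ) = s) ∨
    volume {z : ℝ × ℝ | ∑ j, v j * (κ * (z.1 + k j * z.2) ^ 2 + σ * (z.1 + k j * z.2) + τ) = s}
      = 0 := by
  set m0 := ∑ j, v j with hm0
  set m1 := ∑ j, v j * k j with hm1
  set m2 := ∑ j, v j * (k j : ℝ) ^ 2 with hm2
  have key : ∀ x y : ℝ, ∑ j, v j * (κ * (x + k j * y) ^ 2 + σ * (x + k j * y) + τ) =
      κ * m0 * x ^ 2 + 2 * (κ * m1) * x * y + κ * m2 * y ^ 2 + σ * m0 * x + σ * m1 * y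
        + τ * m0 := by
    intro x y
    rw [hm0, hm1, hm2]
    simp only [Fin.sum_univ_four]
    ring
  by_cases h : κ * m0 = 0 ∧ 2 * (κ * m1) = 0 ∧ κ * m2 = 0 ∧ σ * m0 = 0 ∧ σ * m1 = 0 ∧
      τ * m0 - s = 0
  · left
    obtain ⟨e1, e2, e3, e4, e5, e6⟩ := h
    refine ⟨⟨e1, by linarith, e3⟩, fun x y => ?_⟩
    rw [key, e1, e2, e3, e4, e5]; linarith
  · right
    refine measure_mono_null ?_ (quad2_null h)
    intro z hz
    have hz : ∑ j, v j * (κ * (z.1 + k j * z.2) ^ 2 + σ * (z.1 + k j * z.2) + τ) = s := hz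
    rw [key] at hz
    simp only [mem_setOf_eq]
    linarith

lemma shear_pos {F : Set (ℝ × ℝ)} (hF : MeasurableSet F) (c : ℝ) (h : 0 < volume F) :
    0 < volume ((fun z : ℝ × ℝ => (z.1 - c * z.2, z.2)) ⁻¹' F) := by
  have hm : Measurable (fun z : ℝ × ℝ => (z.1 - c * z.2, z.2)) := by fun_prop
  rw [Measure.volume_eq_prod, Measure.prod_apply_symm (hm hF)]
  rw [Measure.volume_eq_prod, Measure.prod_apply_symm hF] at h
  convert h using 1
  refine lintegral_congr fun y => ?_
  rw [← measure_preimage_add_right volume (-(c * y)) ((fun x => (x, y)) ⁻¹' F)]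
  congr 1

lemma exists_quad (φ : ℝ → ℝ) (hφ : Continuous φ)
    (S : Set ℝ) (hS : S.Finite) (N : ℤ)
    (hyp : ∀ x y : ℝ, ∃ t ∈ Trip S N, ∑ j, t.1 j * φ (x + (t.2.1 j : ℝ) * y) = t.2.2)
    {E : Set ℝ} (hE : IsClosed E) (hpos : 0 < volume E) :
    ∃ κ σ τ : ℝ, 0 < volume {u : ℝ | u ∈ E ∧ φ u = κ * u ^ 2 + σ * u + τ} := by
  obtain ⟨p, hp⟩ : ∃ p, IsDens E p := by
    by_contra hcon
    push Not at hcon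
    refine hpos.ne' (measure_mono_null ?_ (ae_isDens hE.measurableSet))
    intro x hx h
    exact hcon x (h hx)
  have hA := ap_pos hp N
  set A := {z : ℝ × ℝ | ∀ k : ℤ, 1 ≤ k → k ≤ N → z.1 + k * z.2 ∈ E} with hAdef
  have hAc : IsClosed A := by
    rw [hAdef]
    simp only [setOf_forall]
    refine isClosed_iInter fun k => isClosed_iInter fun _ => isClosed_iInter fun _ => ?_
    exact hE.preimage (f := fun z : ℝ × ℝ => z.1 + k * z.2) (by fun_prop)
  set F : ((Fin 4 → ℝ) × (Fin 4 → ℤ) × ℝ) → Set (ℝ × ℝ) := fun t =>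
    {z | ∑ j, t.1 j * φ (z.1 + (t.2.1 j : ℝ) * z.2) = t.2.2} with hFdef
  have hFc : ∀ t, IsClosed (F t) := by
    intro t
    exact isClosed_eq (by fun_prop) (by fun_prop)
  obtain ⟨t, ht, htpos⟩ : ∃ t ∈ Trip S N, 0 < volume (F t ∩ A) := by
    by_contra hcon
    push Not at hcon
    have : volume (⋃ t ∈ Trip S N, F t ∩ A) = 0 := by
      rw [measure_biUnion_null_iff (trip_finite hS N).countable]
      intro t ht
      simpa using hcon t ht
    refine hA.ne' (measure_mono_null ?_ this)
    intro z hz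
    obtain ⟨t, ht, h⟩ := hyp z.1 z.2
    exact mem_biUnion ht ⟨h, hz⟩
  obtain ⟨v, k, s⟩ := t
  obtain ⟨hv, hk, hkN, -⟩ := ht
  simp only at hv hk hkN
  have hm := ((hFc (v, k, s)).inter hAc).measurableSet
  have hΓ := shear_pos hm (k 0 : ℝ) htpos
  have hn : ∀ j, j ≠ 0 → 1 ≤ |(k j : ℝ) - k 0| := by
    intro j hj
    have : k j - k 0 ≠ 0 := fun h => hj (hk (sub_eq_zero.mp h))
    exact_mod_cast Int.one_le_abs this
  have hsm : Measurable (fun z : ℝ × ℝ => (z.1 - (k 0 : ℝ) * z.2, z.2)) := by fun_prop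
  obtain ⟨κ, σ, τ, h⟩ := stage_one (f := fun u => v 0 * φ u) (g2 := fun u => v 1 * φ u)
    (g3 := fun u => v 2 * φ u) (g4 := fun u => v 3 * φ u) (s := s) (by fun_prop)
    (hn 1 (by decide)) (hn 2 (by decide)) (hn 3 (by decide)) (hsm hm) hΓ (by
      rintro u y ⟨h1, -⟩
      have h1 : ∑ j, v j * φ (u - (k 0 : ℝ) * y + (k j : ℝ) * y) = s := h1
      rw [← h1, Fin.sum_univ_four]
      ring_nf)
  have hv0 := v_zero hv
  refine ⟨κ / v 0, σ / v 0, τ / v 0, h.trans_le (measure_mono ?_)⟩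
  rintro u ⟨h1, y, -, h2⟩
  refine ⟨?_, ?_⟩
  · have := h2 (k 0) (hkN 0).1 (hkN 0).2
    simpa using this
  · have : v 0 ≠ 0 := by linarith
    field_simp
    linarith

theorem main_lemma (φ : ℝ → ℝ) (hφ : Continuous φ)
    (S : Set ℝ) (hS : S.Finite) (N : ℤ) (hN : 4 ≤ N)
    (hyp : ∀ x y : ℝ, ∃ v ∈ Vfam, ∃ k : Fin 4 → ℤ,
      Function.Injective k ∧ (∀ j, 1 ≤ k j ∧ k j ≤ N) ∧
      (∑ j : Fin 4, v j * φ (x + (k j : ℝ) * y)) ∈ S) :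
    volume (NonlinSet φ) = 0 := by
  by_contra hne
  have hyp' : ∀ x y : ℝ, ∃ t ∈ Trip S N,
      ∑ j, t.1 j * φ (x + (t.2.1 j : ℝ) * y) = t.2.2 := by
    intro x y
    obtain ⟨v, hv, k, h1, h2, h3⟩ := hyp x y
    exact ⟨(v, k, _), ⟨hv, h1, h2, h3⟩, rfl⟩
  have hEc := nonlin_closed φ
  obtain ⟨κ, σ, τ, hpos⟩ := exists_quad φ hφ S hS N hyp' hEc (pos_iff_ne_zero.mpr hne)
  set G := {u : ℝ | u ∈ NonlinSet φ ∧ φ u = κ * u ^ 2 + σ * u + τ} with hG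
  have hGm : MeasurableSet G :=
    (hEc.inter (isClosed_eq (f := φ) (g := fun u => κ * u ^ 2 + σ * u + τ) (by fun_prop)
      (by fun_prop))).measurableSet
  set D := {u | u ∈ G ∧ IsDens G u} with hDdef
  have hnull : volume (G \ D) = 0 := by
    refine measure_mono_null ?_ (ae_isDens hGm)
    rintro u ⟨h1, h2⟩ h3
    exact h2 ⟨h1, h3 h1⟩
  have hD : ∀ p ∈ D, IsDens D p := fun p hp => hp.2.of_null hnull
  obtain ⟨p, hp⟩ : D.Nonempty := by
    by_contra hcon
    rw [not_nonempty_iff_eq_empty] at hcon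
    rw [hcon, diff_empty] at hnull
    exact hpos.ne' hnull
  have hA := ap_pos (hD p hp) N
  -- the identically satisfied relations
  set Id : ((Fin 4 → ℝ) × (Fin 4 → ℤ) × ℝ) → Prop := fun t =>
    ∀ x y : ℝ, ∑ j, t.1 j * (κ * (x + t.2.1 j * y) ^ 2 + σ * (x + t.2.1 j * y) + τ) = t.2.2
    with hId
  obtain ⟨z0, hz0, hgen⟩ : ∃ z0 : ℝ × ℝ,
      (∀ k : ℤ, 1 ≤ k → k ≤ N → z0.1 + k * z0.2 ∈ D) ∧
      ∀ t ∈ Trip S N, ∑ j, t.1 j * φ (z0.1 + (t.2.1 j : ℝ) * z0.2) = t.2.2 →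
        Id t ∧ κ * ∑ j, t.1 j = 0 ∧ κ * ∑ j, t.1 j * t.2.1 j = 0 ∧
          κ * ∑ j, t.1 j * (t.2.1 j : ℝ) ^ 2 = 0 := by
    by_contra hcon
    push Not at hcon
    have hn : volume (⋃ t ∈ {t | t ∈ Trip S N ∧ ¬ (Id t ∧ κ * ∑ j, t.1 j = 0 ∧
        κ * ∑ j, t.1 j * t.2.1 j = 0 ∧ κ * ∑ j, t.1 j * (t.2.1 j : ℝ) ^ 2 = 0)},
        {z : ℝ × ℝ | ∑ j, t.1 j * (κ * (z.1 + t.2.1 j * z.2) ^ 2 +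
          σ * (z.1 + t.2.1 j * z.2) + τ) = t.2.2}) = 0 := by
      rw [measure_biUnion_null_iff ((trip_finite hS N).subset (fun t ht => ht.1)).countable]
      rintro t ⟨ht, hnt⟩
      rcases quad_rel κ σ τ t.1 t.2.1 t.2.2 with h | h
      · exact absurd ⟨h.2, h.1⟩ hnt
      · exact h
    refine hA.ne' (measure_mono_null ?_ hn)
    intro z hz
    obtain ⟨t, ht, h1, h2⟩ := hcon z hz
    refine mem_biUnion (x := t) ⟨ht, ?_⟩ ?_
    · rintro ⟨h3, h4, h5, h6⟩
      exact h2 h3 h4 h5 h6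
    · simp only [mem_setOf_eq]
      rw [← h1]
      refine Finset.sum_congr rfl fun j _ => ?_
      obtain ⟨-, -, hk, -⟩ := ht
      rw [(hz (t.2.1 j) (hk j).1 (hk j).2).1.2]
  have hκ : κ = 0 := by
    obtain ⟨t, ht, h⟩ := hyp' z0.1 z0.2
    obtain ⟨-, h0, h1, h2⟩ := hgen t ht h
    by_contra hκ
    exact v_moment ht.1 ht.2.1 ((mul_eq_zero.mp h0).resolve_left hκ)
      ((mul_eq_zero.mp h1).resolve_left hκ) ((mul_eq_zero.mp h2).resolve_left hκ)
  set ψ : ℝ → ℝ := fun u => φ u - (σ * u + τ) with hψ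
  have hψc : Continuous ψ := by fun_prop
  have hψ0 : ∀ p ∈ D, ψ p = 0 := by
    intro p hp
    have := hp.1.2
    rw [hκ] at this
    simp only [hψ, this]; ring
  have hcl : ∀ p ∈ D, ∀ ε > 0, ∃ u, |u - p| < ε ∧ ψ u ≠ 0 := by
    intro p hp ε hε
    by_contra hcon
    push Not at hcon
    refine hp.1.1 ⟨ε, hε, σ, τ, fun u hu => ?_⟩
    have := hcon u hu
    simp only [hψ] at this
    linarith
  -- relations which are not identical fail on an open set
  set U : Set (ℝ × ℝ) := ⋂ t ∈ {t | t ∈ Trip S N ∧ ¬ Id t},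
    {z : ℝ × ℝ | ∑ j, t.1 j * φ (z.1 + (t.2.1 j : ℝ) * z.2) ≠ t.2.2} with hU
  have hUo : IsOpen U := by
    refine ((trip_finite hS N).subset (fun t ht => ht.1)).isOpen_biInter fun t _ => ?_
    exact isOpen_ne_fun (by fun_prop) (by fun_prop)
  have hz0U : z0 ∈ U := by
    refine mem_iInter₂.mpr fun t ht h => ?_
    exact ht.2 (hgen t ht.1 h).1
  have main : ∀ n : ℕ, (n : ℤ) ≤ N → ∃ x y : ℝ, (x, y) ∈ U ∧
      (∀ k : ℤ, 1 ≤ k → k ≤ n → ψ (x + k * y) ≠ 0) ∧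
      (∀ k k' : ℤ, 1 ≤ k → k < k' → k' ≤ n → 10 * |ψ (x + k' * y)| < |ψ (x + k * y)|) ∧
      (∀ k : ℤ, (n : ℤ) < k → k ≤ N → x + k * y ∈ D) := by
    intro n
    induction n with
    | zero =>
      intro _
      refine ⟨z0.1, z0.2, hz0U, ?_, ?_, ?_⟩
      · intro k h1 h2; push_cast at h2; omega
      · intro k k' h1 h2 h3; push_cast at h3; omega
      · intro k h1 h2; exact hz0 k (by push_cast at h1; omega) h2
    | succ n ih =>
      intro hn
      push_cast at hn
      obtain ⟨x, y, h1, h2, h3, h4⟩ := ih (by omega)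
      have hp0 : ψ (x + ((n + 1 : ℤ) : ℝ) * y) = 0 := hψ0 _ (h4 _ (by omega) hn)
      set W1 : Set (ℝ × ℝ) := ⋂ k ∈ Icc (1 : ℤ) n, {z | ψ (z.1 + k * z.2) ≠ 0} with hW1
      set W2 : Set (ℝ × ℝ) := ⋂ q ∈ {q ∈ Icc (1 : ℤ) n ×ˢ Icc (1 : ℤ) (n + 1) | q.1 < q.2},
        {z | 10 * |ψ (z.1 + q.2 * z.2)| < |ψ (z.1 + q.1 * z.2)|} with hW2
      have hW1o : IsOpen W1 := by
        refine (finite_Icc _ _).isOpen_biInter fun k _ => ?_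
        exact isOpen_ne_fun (by fun_prop) (by fun_prop)
      have hW2o : IsOpen W2 := by
        refine (((finite_Icc _ _).prod (finite_Icc _ _)).subset
          (fun q hq => hq.1)).isOpen_biInter fun q _ => ?_
        exact isOpen_lt (by fun_prop) (by fun_prop)
      have hmem : (x, y) ∈ U ∩ W1 ∩ W2 := by
        refine ⟨⟨h1, mem_iInter₂.mpr fun k hk => h2 k hk.1 hk.2⟩, mem_iInter₂.mpr ?_⟩
        rintro ⟨k, k'⟩ ⟨⟨hk, hk'⟩, hlt⟩
        simp only [mem_Icc] at hk hk' hlt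
        simp only [mem_setOf_eq]
        by_cases hk'n : k' = n + 1
        · rw [hk'n, hp0, abs_zero, mul_zero, abs_pos]
          exact h2 k hk.1 hk.2
        · exact h3 k k' hk.1 hlt (by omega)
      obtain ⟨x', y', ⟨⟨g1, g2⟩, g3⟩, g4, g5⟩ := ap_step hD hψ0 hcl hn h4
        (((hUo.inter hW1o).inter hW2o).mem_nhds hmem)
      refine ⟨x', y', g1, ?_, ?_, ?_⟩
      · intro k hk1 hk2
        push_cast at hk2
        by_cases hkn : k = n + 1
        · rw [hkn]; exact g4
        · exact mem_iInter₂.mp g2 k ⟨hk1, by omega⟩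
      · intro k k' hk1 hlt hk2
        push_cast at hk2
        exact mem_iInter₂.mp g3 (k, k') ⟨⟨⟨hk1, by simp only; omega⟩, ⟨by simp only; omega, hk2⟩⟩, hlt⟩
      · intro k hk1 hk2
        exact g5 k (by push_cast at hk1; omega) hk2
  obtain ⟨x, y, hxU, hx1, hx2, -⟩ := main N.toNat (by omega)
  have hNN : ((N.toNat : ℕ) : ℤ) = N := by omega
  rw [hNN] at hx1 hx2
  obtain ⟨t, ht, h⟩ := hyp' x y
  by_cases hid : Id t
  · have h5 := hid x y
    obtain ⟨hv, hk, hkN, -⟩ := ht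
    refine lacunary hv hk (w := fun k => ψ (x + k * y)) (fun j => hx1 _ (hkN j).1 (hkN j).2)
      (fun i j hij => hx2 _ _ (hkN i).1 hij (hkN j).2) ?_
    rw [hκ] at h5
    calc ∑ j, t.1 j * ψ (x + (t.2.1 j : ℝ) * y)
        = ∑ j, t.1 j * φ (x + (t.2.1 j : ℝ) * y) -
          ∑ j, t.1 j * (0 * (x + t.2.1 j * y) ^ 2 + σ * (x + t.2.1 j * y) + τ) := by
          rw [← Finset.sum_sub_distrib]
          refine Finset.sum_congr rfl fun j _ => ?_
          simp only [hψ]; ring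
      _ = 0 := by rw [h, h5, sub_self]
  · exact mem_iInter₂.mp hxU t ⟨ht, hid⟩ h
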